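/- arXiv:2012.09246 — 6 statements merged into one kernel-verified Lean document; each statement's English description precedes it below -/
import Mathlib

section
/- Consider N units with covariates x_i ∈ ℝ^k, potential outcomes y_i(0), y_i(1) ∈ ℝ, and treatment indicators Z_i ∈ {0,1}. For z = 0,1 suppose (β_z, γ_z) ∈ ℝ^k × ℝ minimizes Σ_{i : Z_i = z} (y_i(z) − βᵀx_i − γ)², and set μ̂_z(x) = β_zᵀx + γ_z. Then for z = 0,1: (i) for every (a, b, η) ∈ ℝ³, Σ_{i : Z_i = z} (y_i(z) − a·μ̂_0(x_i) − b·μ̂_1(x_i) − η)² ≥ Σ_{i : Z_i = z} (y_i(z) − μ̂_z(x_i))², i.e. μ̂_z itself attains the minimum of the calibration least-squares problem; and (ii) if the calibration problem for group z has a unique minimizing coefficient vector (â_z, b̂_z, η̂_z), then the calibrated prediction function μ̂_{OLS,z}(x) = â_z·μ̂_0(x) + b̂_z·μ̂_1(x) + η̂_z satisfies μ̂_{OLS,z}(x_i) = μ̂_z(x_i) for every i = 1,…,N, so that the calibrated Oaxaca–Blinder estimator τ̂_cal coincides with Lin's regression-adjusted estimator τ̂_lin (the imputation estimator formed from μ̂_0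 and μ̂_1). -/
open Finset

/-- The imputation (generalized Oaxaca–Blinder) estimator formed from prediction
functions `m0, m1`: `N⁻¹ Σᵢ (ŷᵢ(1) − ŷᵢ(0))` where `ŷᵢ(z) = yᵢ(z)` if `Zᵢ = z` and
`ŷᵢ(z) = m_z(xᵢ)` otherwise. -/
noncomputable def imputeEst {N k : ℕ} (Z : Fin N → Fin 2) (y : Fin 2 → Fin N → ℝ)
    (x : Fin N → Fin k → ℝ) (m0 m1 : (Fin k → ℝ) → ℝ) : ℝ :=
  (N : ℝ)⁻¹ * ∑ i, ((if Z i = 1 then y 1 i else m1 (x i)) -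
                    (if Z i = 0 then y 0 i else m0 (x i)))

/-- When the initial prediction functions `μ̂₀, μ̂₁` are themselves fitted by separate
OLS regressions (with intercept) of the outcomes on the covariates within each group,
then (i) `μ̂_z` attains the minimum of the calibration least-squares problem for group
`z`, and (ii) if the calibration problem has a unique minimizing coefficient vector,
the calibrated predictions agree with `μ̂_z` at every `xᵢ`, so the calibrated estimator
`τ̂_cal` coincides with Lin's regression-adjusted estimator `τ̂_lin`. -/
theorem stmt5 {N k : ℕ} (x : Fin N → Fin k → ℝ) (y : Fin 2 → Fin N → ℝ)
    (Z : Fin N → Fin 2) (β : Fin 2 → Fin k → ℝ) (γ : Fin 2 → ℝ)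
    (hOLS : ∀ z : Fin 2, ∀ (β' : Fin k → ℝ) (γ' : ℝ),
      ∑ i ∈ univ.filter (fun i => Z i = z),
        (y z i - ((∑ j, β z j * x i j) + γ z)) ^ 2 ≤
      ∑ i ∈ univ.filter (fun i => Z i = z),
        (y z i - ((∑ j, β' j * x i j) + γ')) ^ 2)
    (μ : Fin 2 → (Fin k → ℝ) → ℝ)
    (hμ : ∀ (z : Fin 2) (v : Fin k → ℝ), μ z v = (∑ j, β z j * v j) + γ z) :
    -- (i): μ̂_z attains the minimum of the calibration problem for group z
    (∀ z : Fin 2, ∀ a b η : ℝ,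
      ∑ i ∈ univ.filter (fun i => Z i = z), (y z i - μ z (x i)) ^ 2 ≤
      ∑ i ∈ univ.filter (fun i => Z i = z),
        (y z i - (a * μ 0 (x i) + b * μ 1 (x i) + η)) ^ 2)
    ∧
    -- (ii): with unique calibration minimizers, calibrated predictions equal μ̂_z
    -- at every xᵢ, and τ̂_cal = τ̂_lin
    (∀ A B H : Fin 2 → ℝ,
      (∀ z : Fin 2, ∀ a b η : ℝ,
        ∑ i ∈ univ.filter (fun i => Z i = z),
          (y z i - (A z * μ 0 (x i) + B z * μ 1 (x i) + H z)) ^ 2 ≤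
        ∑ i ∈ univ.filter (fun i => Z i = z),
          (y z i - (a * μ 0 (x i) + b * μ 1 (x i) + η)) ^ 2) →
      (∀ z : Fin 2, ∀ a b η : ℝ,
        (∀ a' b' η' : ℝ,
          ∑ i ∈ univ.filter (fun i => Z i = z),
            (y z i - (a * μ 0 (x i) + b * μ 1 (x i) + η)) ^ 2 ≤
          ∑ i ∈ univ.filter (fun i => Z i = z),
            (y z i - (a' * μ 0 (x i) + b' * μ 1 (x i) + η')) ^ 2) →
        (a, b, η) = (A z, B z, H z)) →
      (∀ (z : Fin 2) (i : Fin N),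
        A z * μ 0 (x i) + B z * μ 1 (x i) + H z = μ z (x i)) ∧
      imputeEst Z y x (fun v => A 0 * μ 0 v + B 0 * μ 1 v + H 0)
                      (fun v => A 1 * μ 0 v + B 1 * μ 1 v + H 1) =
        imputeEst Z y x (μ 0) (μ 1)) := by
  have key : ∀ z : Fin 2, ∀ a b η : ℝ,
      ∑ i ∈ univ.filter (fun i => Z i = z), (y z i - μ z (x i)) ^ 2 ≤
      ∑ i ∈ univ.filter (fun i => Z i = z),
        (y z i - (a * μ 0 (x i) + b * μ 1 (x i) + η)) ^ 2 := by
    intro z a b η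
    have h := hOLS z (fun j => a * β 0 j + b * β 1 j) (a * γ 0 + b * γ 1 + η)
    have e : ∀ i, (∑ j, (a * β 0 j + b * β 1 j) * x i j) + (a * γ 0 + b * γ 1 + η)
        = a * μ 0 (x i) + b * μ 1 (x i) + η := by
      intro i
      simp only [hμ, add_mul, Finset.sum_add_distrib, mul_add, Finset.mul_sum, mul_assoc]
      ring
    simp only [e, ← hμ] at h
    exact h
  refine ⟨key, ?_⟩
  intro A B H _ huniq
  have h0 := huniq 0 1 0 0 (by
    intro a b η
    simpa using key 0 a b η)
  have h1 := huniq 1 0 1 0 (by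
    intro a b η
    simpa using key 1 a b η)
  simp only [Prod.mk.injEq] at h0 h1
  obtain ⟨a0, b0, c0⟩ := h0
  obtain ⟨a1, b1, c1⟩ := h1
  refine ⟨?_, ?_⟩
  · intro z i
    fin_cases z
    · simp [← a0, ← b0, ← c0]
    · simp [← a1, ← b1, ← c1]
  · simp [← a0, ← b0, ← c0, ← a1, ← b1, ← c1]
end

section
/- Consider N units with covariates x_i ∈ ℝ^k, potential outcomes y_i(0), y_i(1) ∈ ℝ, and treatment indicators Z_i ∈ {0,1}. Let μ̂_0, μ̂_1 : ℝ^k → ℝ be arbitrary prediction functions, and for z = 0,1 let (â_z, b̂_z, η̂_z) ∈ ℝ³ minimize Σ_{i : Z_i = z} (y_i(z) − a·μ̂_0(x_i) − b·μ̂_1(x_i) − η)², with μ̂_{OLS,z} = â_z μ̂_0 + b̂_z μ̂_1 + η̂_z. Then calibration is idempotent: for z = 0,1, (i) for every (a, b, η) ∈ ℝ³, Σ_{i : Z_i = z} (y_i(z) − a·μ̂_{OLS,0}(x_i) − b·μ̂_{OLS,1}(x_i) − η)² ≥ Σ_{i : Z_i = z} (y_i(z) − μ̂_{OLS,z}(x_i))²,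 i.e. μ̂_{OLS,z} attains the minimum of the second-stage calibration problem built from the pseudo-features (μ̂_{OLS,0}(x_i), μ̂_{OLS,1}(x_i)); and (ii) if the second-stage calibration problem has a unique minimizing coefficient vector, the twice-calibrated prediction function μ̂_{OLS2,z} agrees with μ̂_{OLS,z} at every x_i, so the resulting estimator is unchanged (φ ∘ φ = φ). -/
open Finset

/-- Idempotence of linear calibration: if `μ̂_{OLS,z} = â_z μ̂₀ + b̂_z μ̂₁ + η̂_z` is
obtained by least-squares calibration of arbitrary prediction functions `μ̂₀, μ̂₁`,
then (i) `μ̂_{OLS,z}` attains the minimum of the second-stage calibration problem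
built from the pseudo-features `(μ̂_{OLS,0}(xᵢ), μ̂_{OLS,1}(xᵢ))`, and (ii) if the
second-stage problem has a unique minimizing coefficient vector, the twice-calibrated
prediction function agrees with `μ̂_{OLS,z}` at every `xᵢ` and the resulting estimator
is unchanged (`φ ∘ φ = φ`). -/
theorem stmt6 {N k : ℕ} (x : Fin N → Fin k → ℝ) (y : Fin 2 → Fin N → ℝ)
    (Z : Fin N → Fin 2) (μ : Fin 2 → (Fin k → ℝ) → ℝ)
    (A B H : Fin 2 → ℝ)
    (hcal : ∀ z : Fin 2, ∀ a b η : ℝ,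
      ∑ i ∈ univ.filter (fun i => Z i = z),
        (y z i - (A z * μ 0 (x i) + B z * μ 1 (x i) + H z)) ^ 2 ≤
      ∑ i ∈ univ.filter (fun i => Z i = z),
        (y z i - (a * μ 0 (x i) + b * μ 1 (x i) + η)) ^ 2)
    (μOLS : Fin 2 → (Fin k → ℝ) → ℝ)
    (hμOLS : ∀ (z : Fin 2) (v : Fin k → ℝ),
      μOLS z v = A z * μ 0 v + B z * μ 1 v + H z) :
    -- (i): μ̂_{OLS,z} attains the minimum of the second-stage calibration problem
    (∀ z : Fin 2, ∀ a b η : ℝ,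
      ∑ i ∈ univ.filter (fun i => Z i = z), (y z i - μOLS z (x i)) ^ 2 ≤
      ∑ i ∈ univ.filter (fun i => Z i = z),
        (y z i - (a * μOLS 0 (x i) + b * μOLS 1 (x i) + η)) ^ 2)
    ∧
    -- (ii): with unique second-stage minimizers, twice-calibrated predictions agree
    -- with μ̂_{OLS,z} at every xᵢ, and the estimator is unchanged
    (∀ A' B' H' : Fin 2 → ℝ,
      (∀ z : Fin 2, ∀ a b η : ℝ,
        ∑ i ∈ univ.filter (fun i => Z i = z),
          (y z i - (A' z * μOLS 0 (x i) + B' z * μOLS 1 (x i) + H' z)) ^ 2 ≤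
        ∑ i ∈ univ.filter (fun i => Z i = z),
          (y z i - (a * μOLS 0 (x i) + b * μOLS 1 (x i) + η)) ^ 2) →
      (∀ z : Fin 2, ∀ a b η : ℝ,
        (∀ a' b' η' : ℝ,
          ∑ i ∈ univ.filter (fun i => Z i = z),
            (y z i - (a * μOLS 0 (x i) + b * μOLS 1 (x i) + η)) ^ 2 ≤
          ∑ i ∈ univ.filter (fun i => Z i = z),
            (y z i - (a' * μOLS 0 (x i) + b' * μOLS 1 (x i) + η')) ^ 2) →
        (a, b, η) = (A' z, B' z, H' z)) →
      (∀ (z : Fin 2) (i : Fin N),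
        A' z * μOLS 0 (x i) + B' z * μOLS 1 (x i) + H' z = μOLS z (x i)) ∧
      imputeEst Z y x (fun v => A' 0 * μOLS 0 v + B' 0 * μOLS 1 v + H' 0)
                      (fun v => A' 1 * μOLS 0 v + B' 1 * μOLS 1 v + H' 1) =
        imputeEst Z y x (μOLS 0) (μOLS 1)) := by
  have h1 : ∀ z : Fin 2, ∀ a b η : ℝ,
      ∑ i ∈ univ.filter (fun i => Z i = z), (y z i - μOLS z (x i)) ^ 2 ≤
      ∑ i ∈ univ.filter (fun i => Z i = z),
        (y z i - (a * μOLS 0 (x i) + b * μOLS 1 (x i) + η)) ^ 2 := by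
    intro z a b η
    have h := hcal z (a * A 0 + b * A 1) (a * B 0 + b * B 1) (a * H 0 + b * H 1 + η)
    simp only [hμOLS]
    refine h.trans (le_of_eq ?_)
    refine Finset.sum_congr rfl fun i _ => ?_
    ring
  refine ⟨h1, ?_⟩
  intro A' B' H' _ huniq
  have key : ∀ (z : Fin 2) (v : Fin k → ℝ),
      A' z * μOLS 0 v + B' z * μOLS 1 v + H' z = μOLS z v := by
    rw [Fin.forall_fin_two]
    constructor
    · intro v
      have h := huniq 0 1 0 0 (fun a b η => by simpa using h1 0 a b η)
      simp only [Prod.mk.injEq] at h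
      obtain ⟨ha, hb, hc⟩ := h
      rw [← ha, ← hb, ← hc]
      ring
    · intro v
      have h := huniq 1 0 1 0 (fun a b η => by simpa using h1 1 a b η)
      simp only [Prod.mk.injEq] at h
      obtain ⟨ha, hb, hc⟩ := h
      rw [← ha, ← hb, ← hc]
      ring
  refine ⟨fun z i => key z (x i), ?_⟩
  simp only [key]
end

section
/- Consider N units with covariates x_i, potential outcomes y_i(0), y_i(1) ∈ ℝ, and treatment indicators Z_i ∈ {0,1}. Let m_0, m_1 be prediction functions satisfying prediction unbiasedness: Σ_{i : Z_i = 1} m_1(x_i) = Σ_{i : Z_i = 1} y_i(1) and Σ_{i : Z_i = 0} m_0(x_i) = Σ_{i : Z_i = 0} y_i(0). Define imputed outcomes ŷ_i(z) = y_i(z) if Z_i = z and ŷ_i(z) = m_z(x_i) otherwise. Then the imputation estimator can be written exclusively in terms of predicted values: N^{-1} Σ_{i=1}^N (ŷ_i(1) − ŷ_i(0)) = N^{-1} Σ_{i=1}^N (m_1(x_i) − m_0(x_i)). -/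
open Finset

/-- If the prediction functions are prediction unbiased within their own treatment
groups, the imputation estimator can be written exclusively in terms of the predicted
values: `N⁻¹ Σᵢ (ŷᵢ(1) − ŷᵢ(0)) = N⁻¹ Σᵢ (m₁(xᵢ) − m₀(xᵢ))`. -/
theorem stmt8 {N k : ℕ} (x : Fin N → Fin k → ℝ) (y : Fin 2 → Fin N → ℝ)
    (Z : Fin N → Fin 2) (m : Fin 2 → (Fin k → ℝ) → ℝ)
    (h1 : ∑ i ∈ univ.filter (fun i => Z i = 1), m 1 (x i) =
          ∑ i ∈ univ.filter (fun i => Z i = 1), y 1 i)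
    (h0 : ∑ i ∈ univ.filter (fun i => Z i = 0), m 0 (x i) =
          ∑ i ∈ univ.filter (fun i => Z i = 0), y 0 i) :
    (N : ℝ)⁻¹ * ∑ i, ((if Z i = 1 then y 1 i else m 1 (x i)) -
                      (if Z i = 0 then y 0 i else m 0 (x i))) =
    (N : ℝ)⁻¹ * ∑ i, (m 1 (x i) - m 0 (x i)) := by
  rw [Finset.sum_sub_distrib, Finset.sum_sub_distrib, Finset.sum_ite, Finset.sum_ite, ← h1, ← h0,
    Finset.sum_filter_add_sum_filter_not, Finset.sum_filter_add_sum_filter_not]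
end

section
/- Let N ≥ 1, p ∈ (0,1), let w_1,…,w_N ∈ ℝ^d, and let y(1), y(0) ∈ ℝ^N. For z = 0,1 let (α_z, β_z) ∈ ℝ × ℝ^d minimize Σ_{i=1}^N (y_i(z) − α − βᵀw_i)² over all (α, β), and let e_i(z) = y_i(z) − α_z − β_zᵀw_i be the population least-squares residuals. Then V_p(e(1), e(0)) ≤ V_p(y(1), y(0)); that is, replacing the potential outcomes by their population least-squares residuals never increases the limiting variance of the difference-in-means estimator. This is the population-level inequality underlying Theorem 1 (the calibrated estimator τ̂_cal is asymptotically no less efficient than the unadjusted difference in means τ̂_unadj). -/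
/-- Population variance `S²_u = N⁻¹ Σᵢ (uᵢ − ū)²`. -/
noncomputable def popVar {N : ℕ} (u : Fin N → ℝ) : ℝ :=
  (N : ℝ)⁻¹ * ∑ i, (u i - (N : ℝ)⁻¹ * ∑ j, u j) ^ 2

/-- The limiting (Neyman) variance functional of the difference-in-means estimator:
`V_p(u, v) = p⁻¹ S²_u + (1−p)⁻¹ S²_v − S²_{u−v}`. -/
noncomputable def Vp {N : ℕ} (p : ℝ) (u v : Fin N → ℝ) : ℝ :=
  p⁻¹ * popVar u + (1 - p)⁻¹ * popVar v - popVar (fun i => u i - v i)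

theorem popVar_add_of_orth {N : ℕ} (u e g : Fin N → ℝ) (hu : ∀ i, u i = e i + g i)
    (h1 : ∑ i, e i = 0) (h2 : ∑ i, e i * g i = 0) : popVar u = popVar e + popVar g := by
  have hs : ∑ j, u j = ∑ j, g j := by
    simp only [hu, Finset.sum_add_distrib, h1, zero_add]
  unfold popVar
  rw [hs, h1, ← mul_add]
  generalize (N : ℝ)⁻¹ * ∑ j, g j = m
  congr 1
  have : ∀ i, (u i - m) ^ 2
      = (e i - (N : ℝ)⁻¹ * 0) ^ 2 + (g i - m) ^ 2 + (2 * (e i * g i) - 2 * m * e i) := by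
    intro i; rw [hu]; ring
  simp only [this, Finset.sum_add_distrib, Finset.sum_sub_distrib, ← Finset.mul_sum, h1, h2]
  ring

theorem orth_of_min {N : ℕ} (e l : Fin N → ℝ)
    (h : ∀ t : ℝ, ∑ i, e i ^ 2 ≤ ∑ i, (e i - t * l i) ^ 2) : ∑ i, e i * l i = 0 := by
  set A := ∑ i, e i * l i with hA
  set B := ∑ i, l i ^ 2 with hB
  have hB0 : 0 ≤ B := Finset.sum_nonneg fun i _ => sq_nonneg _
  have key : ∀ t : ℝ, 0 ≤ t ^ 2 * B - 2 * t * A := by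
    intro t
    have h3 : ∑ i, (e i - t * l i) ^ 2 = ∑ i, e i ^ 2 + (t ^ 2 * B - 2 * t * A) := by
      rw [hA, hB, Finset.mul_sum, Finset.mul_sum, ← Finset.sum_sub_distrib,
        ← Finset.sum_add_distrib]
      exact Finset.sum_congr rfl fun i _ => by ring
    have := h t
    linarith
  have h4 := key (A / (B + 1))
  have h5 : (A / (B + 1)) ^ 2 * B - 2 * (A / (B + 1)) * A
      = -(A ^ 2 * (B + 2)) / (B + 1) ^ 2 := by
    field_simp; ring
  rw [h5] at h4
  by_contra hne
  have h6 : 0 < A ^ 2 := by positivity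
  have h7 : 0 < (A ^ 2 * (B + 2)) / (B + 1) ^ 2 := by positivity
  rw [neg_div] at h4
  linarith

theorem Vp_nonneg_aux {N : ℕ} (p : ℝ) (hp0 : 0 < p) (hp1 : p < 1) (u v : Fin N → ℝ) :
    0 ≤ Vp p u v := by
  have hq : 0 < 1 - p := by linarith
  unfold Vp popVar
  rw [Finset.sum_sub_distrib, mul_sub]
  generalize (N : ℝ)⁻¹ * ∑ j, u j = a
  generalize (N : ℝ)⁻¹ * ∑ j, v j = b
  have h : p⁻¹ * ((N : ℝ)⁻¹ * ∑ i, (u i - a) ^ 2)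
      + (1 - p)⁻¹ * ((N : ℝ)⁻¹ * ∑ i, (v i - b) ^ 2)
      - (N : ℝ)⁻¹ * ∑ i, (u i - v i - (a - b)) ^ 2
      = (N : ℝ)⁻¹ * ∑ i, ((1 - p) * (u i - a) + p * (v i - b)) ^ 2 / (p * (1 - p)) := by
    rw [mul_left_comm, mul_left_comm (1 - p)⁻¹, ← mul_add, ← mul_sub, Finset.mul_sum,
      Finset.mul_sum, ← Finset.sum_add_distrib, ← Finset.sum_sub_distrib]
    congr 1
    refine Finset.sum_congr rfl fun i _ => ?_
    have := hq.ne'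
    field_simp
    ring
  rw [h]
  refine mul_nonneg (by positivity) (Finset.sum_nonneg fun i _ => ?_)
  have := mul_pos hp0 hq
  positivity

/-- Population-level non-inferiority underlying Theorem 1: replacing the potential
outcomes by their population least-squares residuals (with intercept) never increases
the limiting variance of the difference-in-means estimator. -/
theorem stmt11 {N d : ℕ} (hN : 1 ≤ N) (p : ℝ) (hp0 : 0 < p) (hp1 : p < 1)
    (w : Fin N → Fin d → ℝ) (y : Fin 2 → Fin N → ℝ)
    (α : Fin 2 → ℝ) (β : Fin 2 → Fin d → ℝ)
    (hmin : ∀ z : Fin 2, ∀ (α' : ℝ) (β' : Fin d → ℝ),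
      ∑ i, (y z i - α z - ∑ j, β z j * w i j) ^ 2 ≤
      ∑ i, (y z i - α' - ∑ j, β' j * w i j) ^ 2) :
    Vp p (fun i => y 1 i - α 1 - ∑ j, β 1 j * w i j)
         (fun i => y 0 i - α 0 - ∑ j, β 0 j * w i j) ≤
      Vp p (y 1) (y 0) := by
  have orth : ∀ (z : Fin 2) (a : ℝ) (b : Fin d → ℝ),
      ∑ i, (y z i - α z - ∑ j, β z j * w i j) * (a + ∑ j, b j * w i j) = 0 := by
    intro z a b
    refine orth_of_min _ _ fun t => ?_
    refine (hmin z (α z + t * a) (fun j => β z j + t * b j)).trans (le_of_eq ?_)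
    refine Finset.sum_congr rfl fun i _ => ?_
    have : ∑ j, (β z j + t * b j) * w i j = ∑ j, β z j * w i j + t * ∑ j, b j * w i j := by
      rw [Finset.mul_sum, ← Finset.sum_add_distrib]
      exact Finset.sum_congr rfl fun j _ => by ring
    rw [this]; ring
  have sum0 : ∀ z : Fin 2, ∑ i, (y z i - α z - ∑ j, β z j * w i j) = 0 := by
    intro z
    simpa using orth z 1 0
  have hy : ∀ z : Fin 2, popVar (y z) = popVar (fun i => y z i - α z - ∑ j, β z j * w i j)
      + popVar (fun i => α z + ∑ j, β z j * w i j) := fun z =>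
    popVar_add_of_orth _ _ _ (fun i => by ring) (sum0 z) (orth z _ _)
  have hd : popVar (fun i => y 1 i - y 0 i)
      = popVar (fun i => (y 1 i - α 1 - ∑ j, β 1 j * w i j)
          - (y 0 i - α 0 - ∑ j, β 0 j * w i j))
      + popVar (fun i => (α 1 + ∑ j, β 1 j * w i j) - (α 0 + ∑ j, β 0 j * w i j)) := by
    refine popVar_add_of_orth _ _ _ (fun i => by ring) ?_ ?_
    · rw [Finset.sum_sub_distrib, sum0, sum0, sub_zero]
    · have h11 := orth 1 (α 1) (β 1)
      have h10 := orth 1 (α 0) (β 0)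
      have h01 := orth 0 (α 1) (β 1)
      have h00 := orth 0 (α 0) (β 0)
      have hc : ∀ a b c e : Fin N → ℝ, ∑ i, (a i - b i) * (c i - e i)
          = ∑ i, a i * c i - ∑ i, a i * e i - (∑ i, b i * c i - ∑ i, b i * e i) := by
        intro a b c e
        simp only [← Finset.sum_sub_distrib]
        exact Finset.sum_congr rfl fun i _ => by ring
      rw [hc, h11, h10, h01, h00]
      ring
  have hnn := Vp_nonneg_aux p hp0 hp1 (fun i => α 1 + ∑ j, β 1 j * w i j)
    (fun i => α 0 + ∑ j, β 0 j * w i j)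
  unfold Vp at hnn ⊢
  rw [hy 1, hy 0, hd]
  linarith
end

section
/- Let N ≥ 1, p ∈ (0,1), let w_1,…,w_N ∈ ℝ^d with W ∈ ℝ^{N×d} the matrix with rows w_iᵀ, and let y(1), y(0) ∈ ℝ^N. For z = 0,1 let (α_z, β_z) ∈ ℝ × ℝ^d minimize Σ_{i=1}^N (y_i(z) − α − βᵀw_i)² over all (α, β). Then for every a, b ∈ ℝ^d, V_p(y(1) − Wβ_1, y(0) − Wβ_0) ≤ V_p(y(1) − Wa, y(0) − Wb); i.e., the population least-squares slope vectors jointly minimize the limiting variance over all linear adjustments. This is the population-level inequality underlying Theorem 2: taking w_i = (μ̇_0(x_i), μ̇_1(x_i)) and comparing the optimal coefficients to the fixed coefficients implicit in the uncalibrated generalized Oaxaca–Blinder estimator and the singly-calibrated estimator shows that τ̂_cal has asymptotic variance no larger than that of τ̂_gOB and τ̂_GBcal. -/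
theorem popVar_orth {N : ℕ} (hN : 1 ≤ N) (e g : Fin N → ℝ) (c : ℝ)
    (h0 : ∑ i, e i = 0) (h1 : ∑ i, e i * g i = 0) :
    popVar (fun i => e i + c) ≤ popVar (fun i => e i + c + g i) := by
  have hN' : (N : ℝ) ≠ 0 := by positivity
  unfold popVar
  apply mul_le_mul_of_nonneg_left _ (by positivity)
  set m := (N : ℝ)⁻¹ * ∑ i, g i with hm
  have e1 : (N : ℝ)⁻¹ * ∑ j, (e j + c) = c := by
    rw [Finset.sum_add_distrib, h0]
    simp
    field_simp
  have e2 : (N : ℝ)⁻¹ * ∑ j, (e j + c + g j) = c + m := by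
    rw [Finset.sum_add_distrib, mul_add, e1]
  rw [e1, e2]
  have key : ∑ i, (e i + c + g i - (c + m)) ^ 2
      = ∑ i, (e i + c - c) ^ 2 + ∑ i, (g i - m) ^ 2
        + 2 * (∑ i, e i * g i) - 2 * m * ∑ i, e i := by
    rw [Finset.mul_sum, Finset.mul_sum, ← Finset.sum_add_distrib, ← Finset.sum_add_distrib,
      ← Finset.sum_sub_distrib]
    exact Finset.sum_congr rfl fun i _ => by ring
  rw [key, h0, h1]
  have : 0 ≤ ∑ i, (g i - m) ^ 2 := Finset.sum_nonneg fun i _ => sq_nonneg _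
  linarith

theorem Vp_eq {N : ℕ} (p : ℝ) (hp0 : 0 < p) (hp1 : p < 1) (u v : Fin N → ℝ) :
    Vp p u v = (p * (1 - p))⁻¹ * popVar (fun i => (1 - p) * u i + p * v i) := by
  have h1 : (1 - p) ≠ 0 := by linarith
  have h0 : p ≠ 0 := hp0.ne'
  unfold Vp popVar
  simp only [Finset.sum_add_distrib, Finset.sum_sub_distrib, ← Finset.mul_sum]
  set a := ∑ j, u j
  set b := ∑ j, v j
  simp only [Finset.mul_sum]
  rw [← Finset.sum_add_distrib, ← Finset.sum_sub_distrib]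
  refine Finset.sum_congr rfl fun i _ => ?_
  generalize (N : ℝ)⁻¹ = n
  field_simp
  ring

theorem normal_eq {N : ℕ} (e q : Fin N → ℝ)
    (h : ∀ t : ℝ, ∑ i, (e i) ^ 2 ≤ ∑ i, (e i + t * q i) ^ 2) : ∑ i, e i * q i = 0 := by
  have h2 : ∀ t : ℝ, 0 ≤ 2 * t * (∑ i, e i * q i) + t ^ 2 * ∑ i, q i ^ 2 := by
    intro t
    have := h t
    have key : ∑ i, (e i + t * q i) ^ 2
        = ∑ i, e i ^ 2 + (2 * t * (∑ i, e i * q i) + t ^ 2 * ∑ i, q i ^ 2) := by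
      rw [Finset.mul_sum, Finset.mul_sum, ← Finset.sum_add_distrib, ← Finset.sum_add_distrib]
      exact Finset.sum_congr rfl fun i _ => by ring
    linarith
  have hQ : 0 ≤ ∑ i, q i ^ 2 := Finset.sum_nonneg fun i _ => sq_nonneg _
  generalize ∑ i, q i ^ 2 = Q at *
  generalize ∑ i, e i * q i = S at *
  have h3 := h2 (-S / (Q + 1))
  have h4 : 2 * (-S / (Q + 1)) * S + (-S / (Q + 1)) ^ 2 * Q
      = -(S ^ 2 * (Q + 2)) / (Q + 1) ^ 2 := by
    field_simp
    ring
  rw [h4, le_div_iff₀ (by positivity)] at h3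
  have : S ^ 2 ≤ 0 := by nlinarith [sq_nonneg S, mul_nonneg (sq_nonneg S) hQ]
  exact pow_eq_zero_iff (two_ne_zero) |>.1 (le_antisymm this (sq_nonneg S))

/-- Population-level optimality underlying Theorem 2: the population least-squares
slope vectors jointly minimize the limiting variance functional over all linear
adjustments, i.e. for all `a, b ∈ ℝ^d`,
`V_p(y(1) − Wβ₁, y(0) − Wβ₀) ≤ V_p(y(1) − Wa, y(0) − Wb)`. -/
theorem stmt12 {N d : ℕ} (hN : 1 ≤ N) (p : ℝ) (hp0 : 0 < p) (hp1 : p < 1)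
    (w : Fin N → Fin d → ℝ) (y : Fin 2 → Fin N → ℝ)
    (α : Fin 2 → ℝ) (β : Fin 2 → Fin d → ℝ)
    (hmin : ∀ z : Fin 2, ∀ (α' : ℝ) (β' : Fin d → ℝ),
      ∑ i, (y z i - α z - ∑ j, β z j * w i j) ^ 2 ≤
      ∑ i, (y z i - α' - ∑ j, β' j * w i j) ^ 2) :
    ∀ a b : Fin d → ℝ,
      Vp p (fun i => y 1 i - ∑ j, β 1 j * w i j)
           (fun i => y 0 i - ∑ j, β 0 j * w i j) ≤
      Vp p (fun i => y 1 i - ∑ j, a j * w i j)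
           (fun i => y 0 i - ∑ j, b j * w i j) := by
  intro a b
  have hn : ∀ z : Fin 2, ∀ (c : ℝ) (γ : Fin d → ℝ),
      ∑ i, (y z i - α z - ∑ j, β z j * w i j) * (c + ∑ j, γ j * w i j) = 0 := by
    intro z c γ
    apply normal_eq
    intro t
    refine (hmin z (α z - t * c) (fun j => β z j - t * γ j)).trans_eq ?_
    refine Finset.sum_congr rfl fun i _ => ?_
    simp only [sub_mul, Finset.sum_sub_distrib, mul_assoc, ← Finset.mul_sum]
    ring
  have hc : ∀ z : Fin 2, ∑ i, (y z i - α z - ∑ j, β z j * w i j) = 0 := by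
    intro z
    simpa using hn z 1 0
  rw [Vp_eq p hp0 hp1, Vp_eq p hp0 hp1]
  have hpp : 0 < 1 - p := by linarith
  apply mul_le_mul_of_nonneg_left _ (by positivity)
  set γ : Fin d → ℝ := fun j => (1 - p) * (β 1 j - a j) + p * (β 0 j - b j) with hγ
  have hγw : ∀ i, ∑ j, γ j * w i j = (1 - p) * (∑ j, β 1 j * w i j - ∑ j, a j * w i j)
      + p * (∑ j, β 0 j * w i j - ∑ j, b j * w i j) := by
    intro i
    rw [← Finset.sum_sub_distrib, ← Finset.sum_sub_distrib, Finset.mul_sum, Finset.mul_sum,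
      ← Finset.sum_add_distrib]
    exact Finset.sum_congr rfl fun j _ => by simp only [hγ]; ring
  have := popVar_orth hN
    (fun i => (1 - p) * (y 1 i - α 1 - ∑ j, β 1 j * w i j)
      + p * (y 0 i - α 0 - ∑ j, β 0 j * w i j))
    (fun i => ∑ j, γ j * w i j) ((1 - p) * α 1 + p * α 0)
    (by rw [Finset.sum_add_distrib, ← Finset.mul_sum, ← Finset.mul_sum, hc, hc]; ring)
    (by
      have h1 := hn 1 0 γ
      have h0 := hn 0 0 γ
      simp only [zero_add] at h1 h0
      simp only [add_mul, mul_assoc]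
      rw [Finset.sum_add_distrib, ← Finset.mul_sum, ← Finset.mul_sum, h1, h0]; ring)
  refine (le_of_eq ?_).trans (this.trans (le_of_eq ?_))
  · congr 1; funext i; ring
  · congr 1; funext i; rw [hγw]; ring
end

section
/- Let N ≥ 1, p ∈ (0,1), let y(1), y(0) ∈ ℝ^N, and for each unit i let w_i ∈ ℝ^d and u_i ∈ ℝ^m be two feature vectors; set v_i = (w_iᵀ, u_iᵀ)ᵀ ∈ ℝ^{d+m}. For z = 0,1 let e^v(z), e^w(z), e^u(z) ∈ ℝ^N denote the residual vectors of population least-squares regressions (with intercept) of y(z) on the features v_i, on w_i, and on u_i respectively. Then V_p(e^v(1), e^v(0)) ≤ V_p(e^w(1), e^w(0)) and V_p(e^v(1), e^v(0)) ≤ V_p(e^u(1), e^u(0)); i.e., regression adjustment on the concatenated feature vector never increases the limiting variance relative to adjustment on either subset of features. This is the population-level inequality behind Theorem A.1: the feature-engineered calibrated estimator τ̂_cal2 is asymptotically no less efficient than both τ̂_cal and Lin's regression-adjusted estimator using the engineered features. -/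
lemma aux_orth {N : ℕ} (e g : Fin N → ℝ)
    (h : ∀ t : ℝ, ∑ i, e i ^ 2 ≤ ∑ i, (e i + t * g i) ^ 2) : ∑ i, e i * g i = 0 := by
  have hex : ∀ t : ℝ, ∑ i, (e i + t * g i) ^ 2
      = ∑ i, e i ^ 2 + 2 * t * (∑ i, e i * g i) + t ^ 2 * ∑ i, g i ^ 2 := by
    intro t
    rw [Finset.mul_sum, Finset.mul_sum, ← Finset.sum_add_distrib, ← Finset.sum_add_distrib]
    exact Finset.sum_congr rfl fun i _ => by ring
  have hC : 0 ≤ ∑ i, g i ^ 2 := Finset.sum_nonneg fun i _ => sq_nonneg _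
  set B := ∑ i, e i * g i
  set C := ∑ i, g i ^ 2
  have h1 := h (-B / (C + 1))
  rw [hex] at h1
  have hC1 : 0 < C + 1 := by linarith
  have h2 : 2 * (-B / (C + 1)) * B + (-B / (C + 1)) ^ 2 * C = -(B ^ 2 * (C + 2) / (C + 1) ^ 2) := by
    field_simp
    ring
  have h3 : B ^ 2 * (C + 2) / (C + 1) ^ 2 ≤ 0 := by linarith
  by_contra hB
  have : 0 < B ^ 2 * (C + 2) / (C + 1) ^ 2 := by positivity
  linarith

lemma aux_popVar {N : ℕ} (e g : Fin N → ℝ) (h1 : ∑ i, e i = 0) (h2 : ∑ i, e i * g i = 0) :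
    popVar e ≤ popVar (fun i => e i + g i) := by
  unfold popVar
  apply mul_le_mul_of_nonneg_left _ (by positivity)
  rw [Finset.sum_add_distrib, h1]
  set c := (N : ℝ)⁻¹ * (0 + ∑ i, g i)
  have : ∑ i, (e i + g i - c) ^ 2 = ∑ i, (e i - (N : ℝ)⁻¹ * 0) ^ 2
      + 2 * (∑ i, e i * g i) - 2 * c * (∑ i, e i) + ∑ i, (g i - c) ^ 2 := by
    rw [Finset.mul_sum, Finset.mul_sum, ← Finset.sum_add_distrib, ← Finset.sum_sub_distrib,
      ← Finset.sum_add_distrib]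
    exact Finset.sum_congr rfl fun i _ => by ring
  rw [this, h1, h2]
  have : 0 ≤ ∑ i, (g i - c) ^ 2 := Finset.sum_nonneg fun i _ => sq_nonneg _
  linarith

lemma aux_Vp {N : ℕ} (p : ℝ) (hp0 : 0 < p) (hp1 : p < 1) (a b : Fin N → ℝ) :
    Vp p a b = (p * (1 - p))⁻¹ * popVar (fun i => (1 - p) * a i + p * b i) := by
  have hq : 1 - p ≠ 0 := by linarith
  have hp : p ≠ 0 := hp0.ne'
  unfold Vp popVar
  simp only [Finset.sum_add_distrib, Finset.sum_sub_distrib, ← Finset.mul_sum]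
  set A := ∑ i, a i
  set B := ∑ i, b i
  simp only [Finset.mul_sum]
  rw [← Finset.sum_add_distrib, ← Finset.sum_sub_distrib]
  refine Finset.sum_congr rfl fun i _ => ?_
  generalize (N : ℝ)⁻¹ = n
  field_simp
  ring

lemma aux_main {N : ℕ} (p : ℝ) (hp0 : 0 < p) (hp1 : p < 1) (e f : Fin 2 → Fin N → ℝ)
    (h1 : ∀ z, ∑ i, e z i = 0) (h2 : ∀ z z', ∑ i, e z i * (f z' i - e z' i) = 0) :
    Vp p (e 1) (e 0) ≤ Vp p (f 1) (f 0) := by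
  rw [aux_Vp p hp0 hp1, aux_Vp p hp0 hp1]
  have hq : 0 < 1 - p := by linarith
  apply mul_le_mul_of_nonneg_left _ (by positivity)
  have := aux_popVar (fun i => (1 - p) * e 1 i + p * e 0 i)
    (fun i => (1 - p) * (f 1 i - e 1 i) + p * (f 0 i - e 0 i)) ?_ ?_
  · refine this.trans (le_of_eq (congrArg popVar ?_))
    funext i
    ring
  · rw [Finset.sum_add_distrib, ← Finset.mul_sum, ← Finset.mul_sum, h1, h1]; ring
  · trans (1 - p) ^ 2 * (∑ i, e 1 i * (f 1 i - e 1 i)) + (1 - p) * p * (∑ i, e 1 i * (f 0 i - e 0 i))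
      + (1 - p) * p * (∑ i, e 0 i * (f 1 i - e 1 i)) + p ^ 2 * (∑ i, e 0 i * (f 0 i - e 0 i))
    · simp only [Finset.mul_sum, ← Finset.sum_add_distrib]
      exact Finset.sum_congr rfl fun i _ => by ring
    · simp [h2]

/-- Population-level inequality behind Theorem A.1: least-squares regression adjustment
(with intercept) on the concatenated feature vector `vᵢ = (wᵢᵀ, uᵢᵀ)ᵀ` never increases
the limiting variance relative to adjustment on either subset of features `wᵢ` or
`uᵢ` alone. -/
theorem stmt13 {N d m : ℕ} (hN : 1 ≤ N) (p : ℝ) (hp0 : 0 < p) (hp1 : p < 1)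
    (w : Fin N → Fin d → ℝ) (u : Fin N → Fin m → ℝ) (y : Fin 2 → Fin N → ℝ)
    (αv : Fin 2 → ℝ) (βvw : Fin 2 → Fin d → ℝ) (βvu : Fin 2 → Fin m → ℝ)
    (αw : Fin 2 → ℝ) (βw : Fin 2 → Fin d → ℝ)
    (αu : Fin 2 → ℝ) (βu : Fin 2 → Fin m → ℝ)
    (hv : ∀ z : Fin 2, ∀ (α' : ℝ) (bw : Fin d → ℝ) (bu : Fin m → ℝ),
      ∑ i, (y z i - αv z - (∑ j, βvw z j * w i j) - (∑ j, βvu z j * u i j)) ^ 2 ≤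
      ∑ i, (y z i - α' - (∑ j, bw j * w i j) - (∑ j, bu j * u i j)) ^ 2)
    (hw : ∀ z : Fin 2, ∀ (α' : ℝ) (b : Fin d → ℝ),
      ∑ i, (y z i - αw z - ∑ j, βw z j * w i j) ^ 2 ≤
      ∑ i, (y z i - α' - ∑ j, b j * w i j) ^ 2)
    (hu : ∀ z : Fin 2, ∀ (α' : ℝ) (b : Fin m → ℝ),
      ∑ i, (y z i - αu z - ∑ j, βu z j * u i j) ^ 2 ≤
      ∑ i, (y z i - α' - ∑ j, b j * u i j) ^ 2) :
    (Vp p (fun i => y 1 i - αv 1 - (∑ j, βvw 1 j * w i j) - (∑ j, βvu 1 j * u i j))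
          (fun i => y 0 i - αv 0 - (∑ j, βvw 0 j * w i j) - (∑ j, βvu 0 j * u i j)) ≤
      Vp p (fun i => y 1 i - αw 1 - ∑ j, βw 1 j * w i j)
           (fun i => y 0 i - αw 0 - ∑ j, βw 0 j * w i j))
    ∧
    (Vp p (fun i => y 1 i - αv 1 - (∑ j, βvw 1 j * w i j) - (∑ j, βvu 1 j * u i j))
          (fun i => y 0 i - αv 0 - (∑ j, βvw 0 j * w i j) - (∑ j, βvu 0 j * u i j)) ≤
      Vp p (fun i => y 1 i - αu 1 - ∑ j, βu 1 j * u i j)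
           (fun i => y 0 i - αu 0 - ∑ j, βu 0 j * u i j)) := by
  have key : ∀ z, ∀ (a : ℝ) (bw : Fin d → ℝ) (bu : Fin m → ℝ),
      ∑ i, (y z i - αv z - (∑ j, βvw z j * w i j) - (∑ j, βvu z j * u i j)) *
        (a + (∑ j, bw j * w i j) + (∑ j, bu j * u i j)) = 0 := by
    intro z a bw bu
    apply aux_orth
    intro t
    refine (hv z (αv z - t * a) (fun j => βvw z j - t * bw j)
      (fun j => βvu z j - t * bu j)).trans (le_of_eq ?_)
    refine Finset.sum_congr rfl fun i _ => ?_
    simp only [sub_mul, Finset.sum_sub_distrib, mul_assoc, ← Finset.mul_sum]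
    ring
  have key1 : ∀ z, ∑ i, (y z i - αv z - (∑ j, βvw z j * w i j) - (∑ j, βvu z j * u i j)) = 0 := by
    intro z
    simpa using key z 1 0 0
  constructor
  · refine aux_main p hp0 hp1
      (fun z i => y z i - αv z - (∑ j, βvw z j * w i j) - (∑ j, βvu z j * u i j))
      (fun z i => y z i - αw z - ∑ j, βw z j * w i j) key1 ?_
    intro z z'
    rw [← key z (αv z' - αw z') (fun j => βvw z' j - βw z' j) (βvu z')]
    refine Finset.sum_congr rfl fun i _ => ?_
    simp only [sub_mul, Finset.sum_sub_distrib]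
    ring
  · refine aux_main p hp0 hp1
      (fun z i => y z i - αv z - (∑ j, βvw z j * w i j) - (∑ j, βvu z j * u i j))
      (fun z i => y z i - αu z - ∑ j, βu z j * u i j) key1 ?_
    intro z z'
    rw [← key z (αv z' - αu z') (βvw z') (fun j => βvu z' j - βu z' j)]
    refine Finset.sum_congr rfl fun i _ => ?_
    simp only [sub_mul, Finset.sum_sub_distrib]
    ring
end
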